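/- arXiv:1611.01769 — 7 statements merged into one kernel-verified Lean document; each statement's English description precedes it below -/
import Mathlib

section
/- Let f_1 f_2 ⋯ f_z be the LZ-End parsing of a string s and let i ≥ 0 be the maximal integer such that the string f_{z−i} f_{z−i+1} ⋯ f_z is a suffix of a string f_1 f_2 ⋯ f_j for some j < z − i. Then, for any letter a, the LZ-End parsing of the string sa is f'_1 f'_2 ⋯ f'_{z'} where z' = z − i, f'_m = f_m for all m < z', and f'_{z'} = f_{z−i} f_{z−i+1} ⋯ f_z a. If no such integer i ≥ 0 exists, then the LZ-End parsing of sa is f_1, f_2, …, f_z, a. -/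
/-- `IsLZEnd s fs` states that `fs` is the LZ-End parsing of the string `s`
(strings are modeled as lists of letters, and a parsing as a list of phrases).
For the `i`-th phrase `fᵢ = fs[i]` (0-based), with `k` the total length of the
preceding phrases `f₁ ⋯ fᵢ₋₁`, the phrase minus its last letter, `fᵢ.dropLast`,
must be the longest prefix of `s[k+1..|s|-1]` that is a suffix of the
concatenation `f₁ ⋯ f_j` of some initial group of phrases properly preceding
`fᵢ` (in 0-based terms: `(fs.take j).flatten` with `j ≤ i`). -/
def IsLZEnd {α : Type*} (s : List α) (fs : List (List α)) : Prop :=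
  s = fs.flatten ∧ (∀ f ∈ fs, f ≠ []) ∧
  ∀ i : ℕ, ∀ hi : i < fs.length,
    ((fs.get ⟨i, hi⟩).dropLast ≠ [] →
      ∃ j ≤ i, (fs.get ⟨i, hi⟩).dropLast <:+ ((fs.take j).flatten)) ∧
    ∀ t : List α,
      t <+: (s.dropLast.drop ((fs.take i).flatten).length) →
      (∃ j ≤ i, t <:+ ((fs.take j).flatten)) →
      t.length ≤ (fs.get ⟨i, hi⟩).dropLast.length

theorem lzEnd_append_aux
    {α : Type*} (s : List α) (fs : List (List α)) (hlz : IsLZEnd s fs) (a : α) (n : ℕ)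
    (hn : n ≤ fs.length)
    (H : ∀ m < n, ¬ ∃ j ≤ m, (fs.drop m).flatten <:+ (fs.take j).flatten)
    (hd : (fs.drop n).flatten ≠ [] → ∃ j ≤ n, (fs.drop n).flatten <:+ (fs.take j).flatten) :
    IsLZEnd (s ++ [a]) (fs.take n ++ [(fs.drop n).flatten ++ [a]]) := by
  obtain ⟨hs, hne, hp⟩ := hlz
  have hdrop : ∀ m, s.drop (fs.take m).flatten.length = (fs.drop m).flatten := by
    intro m
    have h : s = (fs.take m).flatten ++ (fs.drop m).flatten := by
      rw [← List.flatten_append, List.take_append_drop]; exact hs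
    rw [h, List.drop_left]
  have htake : ∀ m ≤ n, ∀ x : List (List α), (fs.take n ++ x).take m = fs.take m := by
    intro m hm x
    rw [List.take_append_of_le_length (by simp; omega), List.take_take, min_eq_left hm]
  refine ⟨?_, ?_, ?_⟩
  · rw [List.flatten_append]
    simp only [List.flatten_cons, List.flatten_nil, List.append_nil]
    rw [← List.append_assoc, ← List.flatten_append, List.take_append_drop, hs]
  · intro f hf
    rcases List.mem_append.1 hf with h | h
    · exact hne f (List.mem_of_mem_take h)
    · simp at h
      simp [h]
  · intro i hi
    have hi' : i ≤ n := by simp at hi; omega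
    rw [List.dropLast_concat, htake i hi', hdrop i]
    rcases Nat.lt_or_eq_of_le hi' with hlt | rfl
    · have hg : (fs.take n ++ [(fs.drop n).flatten ++ [a]]).get ⟨i, hi⟩
          = fs.get ⟨i, by omega⟩ := by
        simp only [List.get_eq_getElem]
        rw [List.getElem_append_left (by simp; omega), List.getElem_take]
      rw [hg]
      obtain ⟨h1, h2⟩ := hp i (by omega)
      refine ⟨?_, ?_⟩
      · intro h
        obtain ⟨j, hj, hjs⟩ := h1 h
        exact ⟨j, hj, by rw [htake j (by omega)]; exact hjs⟩
      · rintro t ht ⟨j, hj, hjs⟩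
        rw [htake j (by omega)] at hjs
        refine h2 t ?_ ⟨j, hj, hjs⟩
        have hlen : t.length ≠ (fs.drop i).flatten.length := by
          intro he
          have := ht.eq_of_length he
          subst this
          exact H i hlt ⟨j, hj, hjs⟩
        have hle := ht.length_le
        have e : s.dropLast.drop (fs.take i).flatten.length = (fs.drop i).flatten.dropLast := by
          rw [← hdrop i]
          simp only [List.dropLast_eq_take, List.drop_take, List.length_drop]
          congr 1
          omega
        rw [e, List.dropLast_eq_take, List.prefix_take_iff]
        exact ⟨ht, by omega⟩
    · have hg : (fs.take i ++ [(fs.drop i).flatten ++ [a]]).get ⟨i, hi⟩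
          = (fs.drop i).flatten ++ [a] := by
        simp only [List.get_eq_getElem]
        rw [List.getElem_append_right (by simp)]
        simp
      rw [hg, List.dropLast_concat]
      refine ⟨?_, ?_⟩
      · intro h
        obtain ⟨j, hj, hjs⟩ := hd h
        exact ⟨j, hj, by rw [htake j hj]; exact hjs⟩
      · intro t ht _
        exact ht.length_le

/-- Lemma 2 of the paper. Let `f₁ f₂ ⋯ f_z` be the LZ-End
parsing of a string `s` and let `i ≥ 0` be the maximal integer such that the
string `f_{z−i} f_{z−i+1} ⋯ f_z` (the last `i + 1` phrases, i.e.
`fs.drop (fs.length - 1 - i)`) is a suffix of a string `f₁ f₂ ⋯ f_j` for some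
`j < z − i`. Then, for any letter `a`, the LZ-End parsing of `s ++ [a]` is
`f'₁ ⋯ f'_{z'}` with `z' = z − i`, `f'_m = f_m` for `m < z'`, and
`f'_{z'} = f_{z−i} ⋯ f_z a`. If no such `i` exists, the LZ-End parsing of
`s ++ [a]` is `f₁, f₂, …, f_z, a`. -/
theorem lzEnd_append_letter
    {α : Type*} (s : List α) (fs : List (List α)) (hlz : IsLZEnd s fs) (a : α) :
    (∀ i < fs.length,
      (∃ j, j + i < fs.length ∧
          (fs.drop (fs.length - 1 - i)).flatten <:+ (fs.take j).flatten) →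
      (∀ i', i < i' → i' < fs.length →
        ¬ ∃ j, j + i' < fs.length ∧
            (fs.drop (fs.length - 1 - i')).flatten <:+ (fs.take j).flatten) →
      IsLZEnd (s ++ [a])
        (fs.take (fs.length - 1 - i) ++
          [(fs.drop (fs.length - 1 - i)).flatten ++ [a]])) ∧
    ((∀ i < fs.length,
        ¬ ∃ j, j + i < fs.length ∧
            (fs.drop (fs.length - 1 - i)).flatten <:+ (fs.take j).flatten) →
      IsLZEnd (s ++ [a]) (fs ++ [[a]])) := by
  constructor
  · rintro i hi ⟨j, hj, hjs⟩ hmax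
    refine lzEnd_append_aux s fs hlz a _ (by omega) ?_ (fun _ => ⟨j, by omega, hjs⟩)
    rintro m hm ⟨j', hj', h⟩
    refine hmax (fs.length - 1 - m) (by omega) (by omega) ⟨j', by omega, ?_⟩
    rwa [show fs.length - 1 - (fs.length - 1 - m) = m by omega]
  · intro hno
    have := lzEnd_append_aux s fs hlz a fs.length le_rfl ?_ (by simp)
    · simpa using this
    rintro m hm ⟨j', hj', h⟩
    refine hno (fs.length - 1 - m) (by omega) ⟨j', by omega, ?_⟩
    rwa [show fs.length - 1 - (fs.length - 1 - m) = m by omega]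
end

section
/- If f_1 f_2 ⋯ f_z is the LZ-End parsing of a string s, then for any letter a, the last phrase in the LZ-End parsing of the string sa is one of the following three strings: (1) f_{z−1} f_z a (when z ≥ 2), (2) f_z a, or (3) the single letter a. -/
/-- Decomposed form of the parsing conditions at one phrase. -/
theorem lz_decomp {α : Type*} {s : List α} {fs : List (List α)} (h : IsLZEnd s fs)
    (l r : List (List α)) (f : List α) (e : fs = l ++ f :: r) :
    f ≠ [] ∧ (∃ l', l' <+: l ∧ f.dropLast <:+ l'.flatten) ∧
    ∀ t, t <+: ((f :: r).flatten).dropLast → ∀ l', l' <+: l → t <:+ l'.flatten →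
      t.length + 1 ≤ f.length := by
  obtain ⟨h1, h2, h3⟩ := h
  subst e
  have hf : f ≠ [] := h2 f (by simp)
  have hfl : 0 < f.length := List.length_pos_iff.2 hf
  obtain ⟨h4, h5⟩ := h3 l.length (by simp)
  simp only [List.get_eq_getElem, List.getElem_append_right (le_refl l.length), Nat.sub_self,
    List.getElem_cons_zero] at h4 h5
  have ht : ∀ j ≤ l.length, (l ++ f :: r).take j = l.take j := by
    intro j hj
    rw [List.take_append_of_le_length hj]
  refine ⟨hf, ?_, ?_⟩
  · by_cases hd : f.dropLast = []
    · exact ⟨[], List.nil_prefix, by simp [hd]⟩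
    · obtain ⟨j, hj, hs⟩ := h4 hd
      rw [ht j hj] at hs
      exact ⟨l.take j, List.take_prefix _ _, hs⟩
  · intro t tp l' hl' hs
    have := h5 t ?_ ⟨l'.length, hl'.length_le, ?_⟩
    · simp at this; omega
    · rw [ht _ le_rfl, h1]
      have hne : (f :: r).flatten ≠ [] := by simp [hf]
      rw [List.flatten_append, List.dropLast_append_of_ne_nil hne]
      simpa using tp
    · rw [ht _ hl'.length_le, ← List.prefix_iff_eq_take.1 hl']
      exact hs

theorem suffix_dropLast {α : Type*} {u v : List α} (h : u <:+ v) : u.dropLast <:+ v.dropLast := by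
  obtain ⟨x, rfl⟩ := h
  by_cases hu : u = []
  · simp [hu]
  · rw [List.dropLast_append_of_ne_nil hu]
    exact List.suffix_append _ _

theorem lz_key {α : Type*} {s : List α} {fs : List (List α)} (H : IsLZEnd s fs)
    (p p' q : List (List α)) (h : List α) (e : fs = p ++ h :: q) (hp : p' <+: p)
    (hw : (h :: q).flatten <:+ p'.flatten) : q = [] ∨ ∃ x, q = [x] := by
  have hne := H.2.1
  have hnil : ∀ r : List (List α), (∀ f ∈ r, f ∈ fs) → r.flatten.length = 0 → r = [] := by
    intro r hr h0
    cases r with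
    | nil => rfl
    | cons x r =>
      have := List.length_pos_iff.2 (hne x (hr x (by simp)))
      simp at h0; simp [h0] at this
  obtain ⟨hh, -, hmax⟩ := lz_decomp H p q h e
  rcases List.eq_nil_or_concat p' with rfl | ⟨p'', g, rfl⟩
  · simp [hh] at hw
  obtain ⟨r, hr⟩ := hp
  obtain ⟨hg, ⟨P, hP, hgP⟩, -⟩ := lz_decomp H p'' (r ++ h :: q) g (by rw [e, ← hr]; simp)
  have hPp : P <+: p := hP.trans ⟨[g] ++ r, by rw [← hr]; simp⟩
  have hgl := List.length_pos_iff.2 hg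
  rw [List.concat_eq_append, List.flatten_append] at hw
  simp only [List.flatten_cons, List.flatten_nil, List.append_nil] at hw hmax
  have hgs : g <:+ p''.flatten ++ g := List.suffix_append _ _
  rcases List.suffix_or_suffix_of_suffix hw hgs with hc | hc
  · left
    have := hmax _ (List.prefix_refl _) P hPp ((suffix_dropLast hc).trans hgP)
    apply hnil q (by rw [e]; simp +contextual)
    simp only [List.length_dropLast, List.length_append] at this
    have := List.length_pos_iff.2 hh
    omega
  · have hq : q.flatten <:+ g := by
      have hqw : q.flatten <:+ h ++ q.flatten := List.suffix_append _ _
      apply List.suffix_of_suffix_length_le hqw hc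
      obtain ⟨u, hu⟩ := hc
      rw [← hu, List.suffix_append_inj_of_length_eq rfl] at hw
      have hup : u <+: (h ++ q.flatten).dropLast := by
        rw [← hu, List.dropLast_append_of_ne_nil hg]
        exact List.prefix_append _ _
      have := hmax u hup p'' ⟨[g] ++ r, by rw [← hr]; simp⟩ hw.1
      have := congrArg List.length hu
      simp only [List.length_append] at this
      omega
    cases q with
    | nil => left; rfl
    | cons x q =>
      right
      refine ⟨x, ?_⟩
      obtain ⟨hx, -, hmax2⟩ := lz_decomp H (p ++ [h]) q x (by simp [e])
      have := hmax2 _ (List.prefix_refl _) P (hPp.trans (List.prefix_append _ _))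
        ((suffix_dropLast hq).trans hgP)
      have hq0 : q = [] := by
        apply hnil q (by rw [e]; simp +contextual)
        simp only [List.length_dropLast, List.flatten_cons, List.length_append] at this
        have := List.length_pos_iff.2 hx
        omega
      rw [hq0]

theorem lz_main {α : Type*} {s : List α} {fs gs : List (List α)} {a : α}
    (H : IsLZEnd s fs) (H' : IsLZEnd (s ++ [a]) gs) (r : List (List α)) :
    ∀ l r', fs = l ++ r → gs = l ++ r' →
    (∃ p h q, fs = p ++ h :: q ∧ gs.getLast? = some ((h :: q).flatten ++ [a]) ∧
      ∃ p', p' <+: p ∧ (h :: q).flatten <:+ p'.flatten) ∨ gs.getLast? = some [a] := by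
  have hflat : ∀ l r r' : List (List α), fs = l ++ r → gs = l ++ r' →
      r'.flatten = r.flatten ++ [a] := by
    intro l r r' e e'
    have h1 := H.1
    have h2 := H'.1
    rw [e] at h1
    rw [e', h1] at h2
    simpa using h2.symm
  have hnil : ∀ r : List (List α), (∀ f ∈ r, f ∈ gs) → r.flatten = [] → r = [] := by
    intro r hr h0
    cases r with
    | nil => rfl
    | cons x r =>
      have := H'.2.1 x (hr x (by simp))
      simp at h0; exact absurd h0.1 this
  induction r with
  | nil =>
    intro l r' e e'
    right
    have hf := hflat _ _ _ e e'
    cases r' with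
    | nil => simp at hf
    | cons g r' =>
      have hg := H'.2.1 g (by simp [e'])
      simp only [List.flatten_cons, List.flatten_nil, List.nil_append] at hf
      rcases List.append_eq_singleton_iff.1 hf with ⟨h1, _⟩ | ⟨h1, h2⟩
      · exact absurd h1 hg
      · have : r' = [] := hnil r' (by rw [e']; simp +contextual) h2
        subst this; subst h1; simp [e']
  | cons f r ih =>
    intro l r' e e'
    have hf := hflat _ _ _ e e'
    cases r' with
    | nil => simp at hf
    | cons g r' =>
    obtain ⟨f1, ⟨lf, hlf, f2⟩, f3⟩ := lz_decomp H l r f e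
    obtain ⟨g1, ⟨lg, hlg, g2⟩, g3⟩ := lz_decomp H' l r' g e'
    have hfp := List.length_pos_iff.2 f1
    have hgp := List.length_pos_iff.2 g1
    rw [hf, List.dropLast_concat] at g3
    have gS : g <+: (f :: r).flatten ++ [a] := by rw [← hf]; simp
    have fS : f <+: (f :: r).flatten ++ [a] := by simp
    have gS' : g.dropLast <+: (f :: r).flatten := by
      apply List.prefix_of_prefix_length_le ((List.dropLast_prefix g).trans gS)
        (List.prefix_append _ _)
      have := gS.length_le
      rw [List.length_append, List.length_singleton] at this
      rw [List.length_dropLast]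
      omega
    have fS' : f.dropLast <+: (f :: r).flatten :=
      (List.dropLast_prefix f).trans (by simp)
    have hfg := g3 _ fS' lf hlf f2
    by_cases hlen : g.dropLast.length = (f :: r).flatten.length
    · left
      have hgS := gS'.eq_of_length hlen
      have hg : g = (f :: r).flatten ++ [a] := by
        apply gS.eq_of_length
        rw [List.length_dropLast] at hlen
        rw [List.length_append, List.length_singleton]
        omega
      have hr' : r' = [] := by
        apply hnil r' (by rw [e']; simp +contextual)
        rw [← hg, List.flatten_cons] at hf
        simpa using hf
      refine ⟨l, f, r, e, ?_, lg, hlg, ?_⟩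
      · rw [e', hr', ← hg]; simp
      · rwa [← hgS]
    · have : g.dropLast <+: (f :: r).flatten.dropLast := by
        apply List.prefix_of_prefix_length_le gS' (List.dropLast_prefix _)
        have := gS'.length_le
        rw [List.length_dropLast (xs := (f :: r).flatten)]
        omega
      have h2 := f3 _ this lg hlg g2
      rw [List.length_dropLast] at hfg h2
      have hge : g = f :=
        (List.prefix_of_prefix_length_le gS fS (by omega)).eq_of_length (by omega)
      subst hge
      have e1 : gs = (l ++ [g]) ++ r' := by simp [e']
      have e0 : fs = (l ++ [g]) ++ r := by simp [e]
      exact ih (l ++ [g]) _ e0 e1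

/-- Lemma 3 of the paper. If `f₁ f₂ ⋯ f_z` is the LZ-End
parsing of a string `s`, then for any letter `a`, the last phrase in the
LZ-End parsing of the string `s ++ [a]` is one of the following three strings:
(1) `f_{z−1} f_z a` (when `z ≥ 2`), (2) `f_z a`, or (3) the single letter `a`. -/
theorem lzEnd_last_phrase_trichotomy
    {α : Type*} (s : List α) (fs gs : List (List α)) (a : α)
    (hlz : IsLZEnd s fs) (hlz' : IsLZEnd (s ++ [a]) gs) (hg : gs ≠ []) :
    (2 ≤ fs.length ∧
      gs.getLast hg = (fs.drop (fs.length - 2)).flatten ++ [a]) ∨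
    (1 ≤ fs.length ∧
      gs.getLast hg = (fs.drop (fs.length - 1)).flatten ++ [a]) ∨
    gs.getLast hg = [a] := by
  rcases lz_main hlz hlz' fs [] gs rfl rfl with ⟨p, h, q, e, hl, p', hp, hw⟩ | hl
  · rw [List.getLast?_eq_some_getLast hg, Option.some_inj] at hl
    rcases lz_key hlz p p' q h e hp hw with rfl | ⟨x, rfl⟩
    · right; left
      rw [hl, e]; simp
    · left
      rw [hl, e]; simp
  · rw [List.getLast?_eq_some_getLast hg, Option.some_inj] at hl
    exact Or.inr (Or.inr hl)
end

section
/- Let z be the number of phrases in the LZ-End parsing of a string s and, for any letter a, let z_a be the number of phrases in the LZ-End parsing of the string sa. Then z_a ∈ {z − 1, z, z + 1}. -/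
/-- `t` is a suffix of a concatenation of some initial phrases of `A`. -/
def LZSuf {α : Type*} (A : List (List α)) (t : List α) : Prop :=
  ∃ j, t <:+ (A.take j).flatten

theorem LZSuf.append {α : Type*} {A : List (List α)} {t : List α} (h : LZSuf A t)
    (B : List (List α)) : LZSuf (A ++ B) t := by
  obtain ⟨j, hj⟩ := h
  refine ⟨min j A.length, ?_⟩
  rw [List.take_append_of_le_length (Nat.min_le_right _ _)]
  rcases le_total j A.length with h | h
  · rwa [Nat.min_eq_left h]
  · rw [Nat.min_eq_right h]
    rw [List.take_of_length_le h] at hj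
    simpa using hj

theorem LZSuf.of_suffix {α : Type*} {A : List (List α)} {t u : List α} (h : LZSuf A t)
    (hu : u <:+ t) : LZSuf A u := by
  obtain ⟨j, hj⟩ := h
  exact ⟨j, hu.trans hj⟩

theorem lz_nil_of_flatten {α : Type*} {B : List (List α)} (hB : ∀ f ∈ B, f ≠ [])
    (h : B.flatten.length = 0) : B = [] := by
  cases B with
  | nil => rfl
  | cons b B =>
    exfalso
    have h1 := hB b (by simp)
    have := List.length_pos_iff.2 h1
    simp at h
    simp_all

theorem IsLZEnd.split {α : Type*} {s : List α} {A B : List (List α)} {f : List α}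
    (h : IsLZEnd s (A ++ f :: B)) :
    LZSuf A f.dropLast ∧ (∀ t, t <+: (f ++ B.flatten).dropLast → LZSuf A t →
      t.length + 1 ≤ f.length) ∧ f ≠ [] ∧ (∀ g ∈ B, g ≠ []) := by
  obtain ⟨hs, hne, h⟩ := h
  have hf : f ≠ [] := hne f (by simp)
  have hpos := List.length_pos_iff.2 hf
  obtain ⟨h1, h2⟩ := h A.length (by simp)
  simp only [List.get_eq_getElem, List.getElem_append_right (le_refl _), Nat.sub_self,
    List.getElem_cons_zero, List.take_left] at h1 h2
  refine ⟨?_, ?_, hf, fun g hg => hne g (by simp [hg])⟩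
  · by_cases h0 : f.dropLast = []
    · exact ⟨0, by simp [h0]⟩
    · obtain ⟨j, hj, hj'⟩ := h1 h0
      rw [List.take_append_of_le_length hj] at hj'
      exact ⟨j, hj'⟩
  · intro t ht ⟨j, hj⟩
    have e : s.dropLast.drop A.flatten.length = (f ++ B.flatten).dropLast := by
      rw [hs, List.flatten_append, List.flatten_cons,
        List.dropLast_append_of_ne_nil (by simp [hf]), List.drop_left]
    have := h2 t (by rw [e]; exact ht) ?_
    · simp at this; omega
    · refine ⟨min j A.length, Nat.min_le_right _ _, ?_⟩
      rw [List.take_append_of_le_length (Nat.min_le_right _ _)]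
      rcases le_total j A.length with h | h
      · rwa [Nat.min_eq_left h]
      · rw [Nat.min_eq_right h]
        rwa [List.take_of_length_le h, ← List.take_length (l := A)] at hj

theorem lz_tail_le_one {α : Type*} {s : List α} {A B : List (List α)} {f : List α}
    (h : IsLZEnd s (A ++ f :: B)) (hw : LZSuf A (f ++ B.flatten)) : B.length ≤ 1 := by
  obtain ⟨-, hmax, hf, hB⟩ := h.split
  obtain ⟨j, hj⟩ := hw
  have hfpos := List.length_pos_iff.2 hf
  rcases List.eq_nil_or_concat (A.take j) with h0 | ⟨A', q, hq⟩
  · rw [h0] at hj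
    simp [hf] at hj
  have hA : A = A' ++ q :: A.drop j := by
    conv_lhs => rw [← List.take_append_drop j A, hq]
    simp
  generalize A.drop j = C at hA
  rw [hq] at hj
  have h' := h
  rw [hA, List.append_assoc, List.cons_append] at h'
  obtain ⟨hq1, -, hqne, -⟩ := h'.split
  have hqA : LZSuf A q.dropLast := by rw [hA]; exact hq1.append _
  have hqpos := List.length_pos_iff.2 hqne
  simp only [List.concat_eq_append, List.flatten_append, List.flatten_cons, List.flatten_nil,
    List.append_nil] at hj
  rcases le_total (f ++ B.flatten).length q.length with hl | hl
  · have hsuf : f ++ B.flatten <:+ q := List.suffix_of_suffix_length_le hj (List.suffix_append _ _) hl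
    have := hmax _ (List.prefix_refl _) (hqA.of_suffix (suffix_dropLast hsuf))
    simp at this
    have : B = [] := lz_nil_of_flatten hB (by simp; omega)
    simp [this]
  · have hsuf : q <:+ f ++ B.flatten := List.suffix_of_suffix_length_le (List.suffix_append _ _) hj hl
    obtain ⟨x, hx⟩ := hsuf
    have hxA : LZSuf A x := by
      rw [← hx] at hj
      have : x <:+ A'.flatten := List.suffix_append_self_iff.1 hj
      refine ⟨A'.length, ?_⟩
      rw [hA]; simpa using this
    have hxl := hmax x (by
      rw [← hx, List.dropLast_append_of_ne_nil hqne]; exact List.prefix_append _ _) hxA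
    have hlen := congrArg List.length hx
    rw [List.length_append, List.length_append] at hlen
    have hy : B.flatten <:+ q := List.suffix_of_suffix_length_le (l₃ := f ++ B.flatten)
      (List.suffix_append _ _) ⟨x, hx⟩ (by omega)
    cases B with
    | nil => simp
    | cons g C' =>
      have h2 : IsLZEnd s ((A ++ [f]) ++ g :: C') := by simpa using h
      obtain ⟨-, hm, hg, hC⟩ := h2.split
      have hgpos := List.length_pos_iff.2 hg
      have := hm _ (List.prefix_refl _) ((hqA.of_suffix (suffix_dropLast hy)).append _)
      simp at this
      have : C' = [] := lz_nil_of_flatten hC (by simp; omega)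
      simp [this]

theorem lz_main_s3 {α : Type*} (s : List α) (a : α) (B : List (List α)) :
    ∀ (A C : List (List α)), IsLZEnd s (A ++ B) → IsLZEnd (s ++ [a]) (A ++ C) →
      C.length + 1 = B.length ∨ C.length = B.length ∨ C.length = B.length + 1 := by
  induction B with
  | nil =>
    intro A C h h'
    have e := h'.1
    rw [h.1] at e
    simp only [List.flatten_append, List.flatten_nil, List.append_nil,
      List.append_cancel_left_eq] at e
    have e := congrArg List.length e
    cases C with
    | nil => simp
    | cons g C =>
      obtain ⟨-, -, hg, hC⟩ := h'.split
      have hgpos := List.length_pos_iff.2 hg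
      rw [List.flatten_cons, List.length_append, List.length_singleton] at e
      have : C = [] := lz_nil_of_flatten hC (by omega)
      simp [this]
  | cons f B ih =>
    intro A C h h'
    have e := h'.1
    rw [h.1] at e
    simp only [List.flatten_append, List.append_assoc, List.flatten_cons,
      List.append_cancel_left_eq] at e
    cases C with
    | nil => simp at e
    | cons g C =>
      obtain ⟨hf1, hf2, hf, hB⟩ := h.split
      obtain ⟨hg1, hg2, hg, hC⟩ := h'.split
      have hgpos := List.length_pos_iff.2 hg
      have hfpos := List.length_pos_iff.2 hf
      rw [List.flatten_cons, ← List.append_assoc] at e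
      have e2 : (g ++ C.flatten).dropLast = f ++ B.flatten := by
        rw [← e, List.dropLast_concat]
      have l1 := hg2 f.dropLast (by
        rw [e2]; exact (List.dropLast_prefix f).trans (List.prefix_append _ _)) hf1
      have hgp : g.dropLast <+: f ++ B.flatten := by
        rw [← e2]
        by_cases hc : C.flatten = []
        · simp [hc]
        · rw [List.dropLast_append_of_ne_nil hc]
          exact (List.dropLast_prefix g).trans (List.prefix_append _ _)
      have elen := congrArg List.length e
      simp only [List.length_append, List.length_singleton] at elen
      rw [List.length_dropLast] at l1
      rcases lt_or_ge g.dropLast.length (f ++ B.flatten).length with hlt | hge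
      · have l2 := hf2 g.dropLast (List.prefix_of_prefix_length_le hgp (List.dropLast_prefix _)
          (by rw [List.length_dropLast (xs := f ++ B.flatten)]; omega)) hg1
        rw [List.length_dropLast] at l2
        have hfg : f = g := by
          rw [List.append_assoc] at e
          exact (List.append_inj e (by omega)).1
        subst hfg
        have := ih (A ++ [f]) C (by simpa using h) (by simpa using h')
        simpa using this
      · have hgw := hgp.eq_of_length_le hge
        rw [hgw] at hg1
        have := lz_tail_le_one h hg1
        have hC0 : C = [] := lz_nil_of_flatten hC (by
          rw [List.length_dropLast, List.length_append] at hge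
          omega)
        subst hC0
        simp only [List.length_cons, List.length_nil]
        omega

/-- Let `z` be the number of phrases in the LZ-End parsing of
a string `s` and, for a letter `a`, let `z_a` be the number of phrases in the
LZ-End parsing of the string `s ++ [a]`. Then `z_a ∈ {z − 1, z, z + 1}`. -/
theorem lzEnd_append_letter_phrase_count
    {α : Type*} (s : List α) (fs gs : List (List α)) (a : α)
    (hlz : IsLZEnd s fs) (hlz' : IsLZEnd (s ++ [a]) gs) :
    gs.length + 1 = fs.length ∨ gs.length = fs.length ∨
      gs.length = fs.length + 1 := by
  exact lz_main_s3 s a fs [] gs hlz hlz'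
end

section
/- Let z and z' denote, respectively, the numbers of phrases in the LZ-End parsings of strings s and s', where s' is a prefix of s. Then 3z ≥ z'. -/
namespace LZE

variable {α : Type*}

/-- Total length of the first `l` phrases. -/
def P (fs : List (List α)) (l : ℕ) : ℕ := ((fs.take l).flatten).length

lemma P_succ (fs : List (List α)) (l : ℕ) (h : l < fs.length) :
    P fs (l+1) = P fs l + (fs[l]).length := by
  unfold P
  rw [List.take_succ_eq_append_getElem h, List.flatten_append, List.length_append]
  simp only [List.flatten_cons, List.flatten_nil, List.append_nil]

lemma take_pre (fs : List (List α)) {a b : ℕ} (h : a ≤ b) :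
    (fs.take a).flatten <+: (fs.take b).flatten := by
  obtain ⟨t, ht⟩ := List.take_prefix_take_left (l := fs) h
  exact ⟨t.flatten, by rw [← ht]; simp⟩

lemma drop_eq (fs : List (List α)) (l : ℕ) :
    fs.flatten.drop (P fs l) = (fs.drop l).flatten := by
  conv_lhs => rw [← List.take_append_drop l fs, List.flatten_append]
  simp [P, List.drop_left']

lemma P_all (s : List α) (fs : List (List α)) (h : IsLZEnd s fs) :
    P fs fs.length = s.length := by
  unfold P; rw [List.take_length, ← h.1]

lemma len_le_of (s : List α) (fs : List (List α)) (h : IsLZEnd s fs) (l : ℕ)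
    (hl : s.drop (P fs l) = []) : fs.length ≤ l := by
  by_contra hc
  push Not at hc
  rw [h.1, drop_eq] at hl
  rw [List.drop_eq_getElem_cons hc, List.flatten_cons, List.append_eq_nil_iff] at hl
  exact h.2.1 _ (List.getElem_mem hc) hl.1

lemma greedy (s : List α) (fs : List (List α)) (h : IsLZEnd s fs) (l : ℕ)
    (hl : l < fs.length) (t : List α) (j : ℕ) (hj : j ≤ l)
    (ht : t <:+ (fs.take j).flatten) (hp : t <+: s.drop (P fs l))
    (hlt : t.length < (s.drop (P fs l)).length) :
    P fs l + t.length + 1 ≤ P fs (l+1) := by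
  have h1 := (h.2.2 l hl).2 t ?_ ⟨j, hj, ht⟩
  · rw [P_succ _ _ hl]
    have : fs[l] ≠ [] := h.2.1 _ (List.getElem_mem hl)
    have := List.length_pos_iff.2 this
    simp at h1
    omega
  · change t <+: s.dropLast.drop (P fs l)
    have : s.dropLast.drop (P fs l) = (s.drop (P fs l)).dropLast := by
      rw [List.dropLast_eq_take, List.dropLast_eq_take, List.drop_take]
      simp; omega
    rw [this, List.dropLast_eq_take, List.prefix_take_iff]
    exact ⟨hp, by omega⟩

lemma src (s : List α) (fs : List (List α)) (h : IsLZEnd s fs) (i : ℕ)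
    (hi : i < fs.length) : (fs[i]).dropLast <:+ (fs.take i).flatten ∨
      ∃ j ≤ i, (fs[i]).dropLast <:+ (fs.take j).flatten := by
  by_cases h0 : (fs[i]).dropLast = []
  · left; rw [h0]; exact List.nil_suffix
  · right; exact (h.2.2 i hi).1 h0

lemma src2 (s : List α) (fs : List (List α)) (h : IsLZEnd s fs) (i : ℕ)
    (hi : i < fs.length) :
      ∃ j ≤ i, (fs[i]).dropLast <:+ (fs.take j).flatten := by
  rcases src s fs h i hi with h | h
  · exact ⟨i, le_rfl, h⟩
  · exact h

lemma infix_dropLast_or {r f : List α} (h : r <:+: f) : r <:+: f.dropLast ∨ r <:+ f := by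
  obtain ⟨a, b, hab⟩ := h
  rcases List.eq_nil_or_concat b with rfl | ⟨b', x, rfl⟩
  · right; exact ⟨a, by simpa using hab⟩
  · left; refine ⟨a, b', ?_⟩
    rw [← hab, List.concat_eq_append, ← List.append_assoc, List.dropLast_concat]

lemma dropLast_suffix {r f : List α} (h : r <:+ f) (hr : r ≠ []) :
    r.dropLast <:+ f.dropLast := by
  obtain ⟨a, rfl⟩ := h
  rw [List.dropLast_append_of_ne_nil hr]
  exact List.suffix_append _ _

/-- Remainder inside a phrase. -/
lemma inPhrase (s : List α) (fs : List (List α)) (h : IsLZEnd s fs) (j l : ℕ)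
    (hj : j < l) (hl : l ≤ fs.length)
    (IH : s.drop (P fs l) <:+: (fs.take j).flatten → fs.length ≤ l + j + 1)
    (hin : s.drop (P fs l) <:+: fs[j]) : fs.length ≤ l + j + 1 := by
  obtain ⟨j', hj', hs⟩ := src2 s fs h j (by omega)
  rcases infix_dropLast_or hin with h1 | h1
  · exact IH (h1.trans (hs.isInfix.trans (take_pre fs hj').isInfix))
  · by_cases h0 : s.drop (P fs l) = []
    · have := len_le_of s fs h l h0
      omega
    · rcases hl.eq_or_lt with e | hl
      · omega
      have hpos := List.length_pos_iff.2 h0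
      have := greedy s fs h l hl (s.drop (P fs l)).dropLast j' (by omega)
        ((dropLast_suffix h1 h0).trans hs) (List.dropLast_prefix _)
        (by rw [List.length_dropLast]; omega)
      have := len_le_of s fs h (l+1) (by
        rw [List.drop_eq_nil_iff]
        simp at this hpos
        omega)
      omega

lemma count (s : List α) (fs : List (List α)) (h : IsLZEnd s fs) (j : ℕ) :
    ∀ l, j ≤ l → l ≤ fs.length → s.drop (P fs l) <:+: (fs.take j).flatten →
      fs.length ≤ l + j + 1 := by
  induction j with
  | zero =>
    intro l _ _ hin
    have := len_le_of s fs h l (by simpa using hin)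
    omega
  | succ j IH =>
    intro l hjl hl hin
    rcases hl.eq_or_lt with e | hl'
    · omega
    have hjf : j < fs.length := by omega
    rw [List.take_succ_eq_append_getElem hjf, List.flatten_append, List.infix_append_iff] at hin
    simp only [List.flatten_cons, List.flatten_nil, List.append_nil] at hin
    rcases hin with hin | hin | ⟨u, v, huv, hu, hv⟩
    · have := IH l (by omega) hl hin
      omega
    · have := inPhrase s fs h j l (by omega) hl (IH l (by omega) hl) hin
      omega
    · by_cases hv0 : v = []
      · have := IH l (by omega) hl (by rw [huv, hv0]; simpa using hu.isInfix)
        omega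
      · have hpos := List.length_pos_iff.2 hv0
        have hg := greedy s fs h l hl' u j (by omega) hu (by rw [huv]; exact List.prefix_append _ _)
          (by rw [huv]; simp; omega)
        have hsuf : s.drop (P fs (l+1)) <:+ v := by
          obtain ⟨d, hd⟩ := Nat.exists_eq_add_of_le (show P fs l + u.length ≤ P fs (l+1) by omega)
          rw [hd, ← List.drop_drop, ← List.drop_drop, huv, List.drop_left]
          exact List.drop_suffix _ _
        have := inPhrase s fs h j (l+1) (by omega) hl' (IH (l+1) (by omega) hl')
          (hsuf.isInfix.trans hv.isInfix)
        omega

lemma getElem_pre (s : List α) (fs : List (List α)) (h : IsLZEnd s fs) (l : ℕ)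
    (hl : l < fs.length) : fs[l] <+: s.drop (P fs l) := by
  rw [h.1, drop_eq, List.drop_eq_getElem_cons hl, List.flatten_cons]
  exact List.prefix_append _ _

lemma greedy2 (s : List α) (fs : List (List α)) (h : IsLZEnd s fs) (l : ℕ)
    (hl : l < fs.length) (f : List α) (hf : f ≠ []) (j : ℕ) (hj : j ≤ l)
    (ht : f.dropLast <:+ (fs.take j).flatten) (hp : f <+: s.drop (P fs l)) :
    f.length ≤ (fs[l]).length := by
  have hpos := List.length_pos_iff.2 hf
  have hle := hp.length_le
  have := greedy s fs h l hl f.dropLast j hj ht ((List.dropLast_prefix _).trans hp)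
    (by rw [List.length_dropLast]; omega)
  rw [P_succ _ _ hl, List.length_dropLast] at this
  omega

lemma agree (s s' : List α) (fs fs' : List (List α))
    (h : IsLZEnd s fs) (h' : IsLZEnd s' fs') (hpre : s' <+: s) (l : ℕ) :
    l ≤ fs.length → P fs l ≤ s'.length → l ≤ fs'.length ∧ fs'.take l = fs.take l := by
  induction l with
  | zero => intros; simp
  | succ l IH =>
    intro hl hP
    have hl : l < fs.length := hl
    rw [P_succ _ _ hl] at hP
    have hne : fs[l] ≠ [] := h.2.1 _ (List.getElem_mem hl)
    have hpos := List.length_pos_iff.2 hne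
    obtain ⟨h1, h2⟩ := IH hl.le (by omega)
    have hPP : P fs' l = P fs l := by unfold P; rw [h2]
    have hl' : l < fs'.length := by
      rcases h1.eq_or_lt with e | h1
      · have := P_all s' fs' h'
        rw [← e, hPP] at this
        omega
      · exact h1
    have hne' : fs'[l] ≠ [] := h'.2.1 _ (List.getElem_mem hl')
    have htk : ∀ j ≤ l, fs'.take j = fs.take j := by
      intro j hj
      have := congrArg (List.take j) h2
      simpa [List.take_take, hj] using this
    have hdp : s'.drop (P fs l) <+: s.drop (P fs l) := hpre.drop _
    have hf := getElem_pre s fs h l hl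
    have hf' := getElem_pre s' fs' h' l hl'
    rw [hPP] at hf'
    obtain ⟨j, hj, hs⟩ := src2 s fs h l hl
    obtain ⟨j', hj', hs'⟩ := src2 s' fs' h' l hl'
    have e1 : (fs[l]).length ≤ (fs'[l]).length := by
      refine greedy2 s' fs' h' l hl' _ hne j hj (by rw [htk j hj]; exact hs) ?_
      rw [hPP]
      exact List.prefix_of_prefix_length_le hf hdp (by rw [List.length_drop]; omega)
    have e2 : (fs'[l]).length ≤ (fs[l]).length :=
      greedy2 s fs h l hl _ hne' j' hj' (by rw [← htk j' hj']; exact hs') (hf'.trans hdp)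
    have e3 : fs'[l] = fs[l] :=
      (List.prefix_of_prefix_length_le (hf'.trans hdp) hf e2).eq_of_length (by omega)
    refine ⟨hl', ?_⟩
    rw [List.take_succ_eq_append_getElem hl, List.take_succ_eq_append_getElem hl', h2, e3]

end LZE

/-- Lemma 4 of the paper. Let `z` and `z'` denote,
respectively, the numbers of phrases in the LZ-End parsings of strings `s`
and `s'`, where `s'` is a prefix of `s`. Then `3z ≥ z'`. -/
theorem lzEnd_prefix_phrase_count
    {α : Type*} (s s' : List α) (fs fs' : List (List α))
    (hlz : IsLZEnd s fs) (hlz' : IsLZEnd s' fs') (hpre : s' <+: s) :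
    fs'.length ≤ 3 * fs.length := by
  classical
  have hex : ∃ i, i ≤ fs.length ∧ LZE.P fs i ≤ s'.length ∧
      (i < fs.length → s'.length < LZE.P fs (i+1)) := by
    by_contra hc
    push Not at hc
    have : ∀ i, i ≤ fs.length → LZE.P fs i ≤ s'.length := by
      intro i
      induction i with
      | zero => intro _; simp [LZE.P]
      | succ i IH => intro hi; exact (hc i (by omega) (IH (by omega))).2
    have := hc fs.length le_rfl (this _ le_rfl)
    omega
  obtain ⟨i, hi, hP, hmax⟩ := hex
  obtain ⟨hi', htk⟩ := LZE.agree s s' fs fs' hlz hlz' hpre i hi hP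
  have hPP : LZE.P fs' i = LZE.P fs i := by unfold LZE.P; rw [htk]
  rcases hi.eq_or_lt with e | hlt
  · have := LZE.len_le_of s' fs' hlz' i (by
      rw [hPP, e, LZE.P_all s fs hlz, List.drop_eq_nil_iff]
      exact hpre.length_le)
    omega
  · have hm := hmax hlt
    rw [LZE.P_succ _ _ hlt] at hm
    obtain ⟨j, hj, hs⟩ := LZE.src2 s fs hlz i hlt
    have hp : s'.drop (LZE.P fs i) <+: (fs[i]).dropLast := by
      refine List.prefix_of_prefix_length_le (hpre.drop _)
        ((List.dropLast_prefix _).trans (LZE.getElem_pre s fs hlz i hlt)) ?_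
      rw [List.length_drop, List.length_dropLast]; omega
    have := LZE.count s' fs' hlz' i i le_rfl hi' (by
      rw [hPP, htk]
      exact hp.isInfix.trans (hs.isInfix.trans (LZE.take_pre fs hj).isInfix))
    omega
end

section
/- Let s' be a prefix of a string s, let f_1 f_2 ⋯ f_z and f'_1 f'_2 ⋯ f'_{z'} be the LZ-End parsings of s and s' respectively, and suppose there is an index i ≥ 0 such that f_m = f'_m for all m with 1 ≤ m ≤ i, while i + 1 ≤ z, i + 1 ≤ z', and f_{i+1} ≠ f'_{i+1}. Then |f_{i+1}| ≥ |f'_{i+1} f'_{i+2} ⋯ f'_{z'}|, i.e., the phrase f_{i+1} is at least as long as the remaining unparsed part of s' after the common prefix f_1 ⋯ f_i; consequently f'_{i+1} f'_{i+2} ⋯ f'_{z'} is a prefix of f_{i+1}. -/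
theorem dropLast_prefix_aux {α : Type*} (p g r : List α) (h : g <+: r) (hg : g ≠ []) :
    g.dropLast <+: ((p ++ r).dropLast.drop p.length) := by
  obtain ⟨u, rfl⟩ := h
  rw [List.dropLast_append_of_ne_nil (by simp [hg]), List.drop_left]
  rcases eq_or_ne u [] with rfl | hu
  · simp
  · rw [List.dropLast_append_of_ne_nil hu]
    exact (List.dropLast_prefix g).trans (List.prefix_append _ _)

theorem le_aux {α : Type*} (s : List α) (fs fs' : List (List α)) (hlz : IsLZEnd s fs)
    (i : ℕ) (hi : i < fs.length) (heq : fs.take i = fs'.take i) (g r : List α)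
    (hs : s = (fs.take i).flatten ++ r) (hg : g <+: r) (hg0 : g ≠ [])
    (hc : g.dropLast ≠ [] → ∃ j ≤ i, g.dropLast <:+ ((fs'.take j).flatten)) :
    g.dropLast.length ≤ (fs.get ⟨i, hi⟩).dropLast.length := by
  by_cases h0 : g.dropLast = []
  · simp [h0]
  · obtain ⟨j, hj, hsuf⟩ := hc h0
    refine (hlz.2.2 i hi).2 _ ?_ ⟨j, hj, ?_⟩
    · have := dropLast_prefix_aux (fs.take i).flatten g r hg hg0
      rwa [← hs] at this
    · have : fs.take j = fs'.take j := by
        have := congrArg (List.take j) heq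
        simpa [List.take_take, Nat.min_eq_left hj] using this
      rwa [this]

/-- Let `s'` be a prefix of a string `s`, let `f₁ ⋯ f_z` and
`f'₁ ⋯ f'_{z'}` be the LZ-End parsings of `s` and `s'` respectively, and
suppose there is an index `i ≥ 0` (0-based here) such that the first `i`
phrases coincide while the `(i+1)`-st phrases exist and differ. Then
`|f_{i+1}| ≥ |f'_{i+1} f'_{i+2} ⋯ f'_{z'}|`, i.e., the phrase `f_{i+1}` is at
least as long as the remaining part of `s'` after the common prefix
`f₁ ⋯ fᵢ`; consequently `f'_{i+1} ⋯ f'_{z'}` is a prefix of `f_{i+1}`. -/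
theorem lzEnd_divergent_phrase_long
    {α : Type*} (s s' : List α) (fs fs' : List (List α))
    (hlz : IsLZEnd s fs) (hlz' : IsLZEnd s' fs') (hpre : s' <+: s)
    (i : ℕ) (hi : i < fs.length) (hi' : i < fs'.length)
    (heq : fs.take i = fs'.take i)
    (hne : fs.get ⟨i, hi⟩ ≠ fs'.get ⟨i, hi'⟩) :
    ((fs'.drop i).flatten).length ≤ (fs.get ⟨i, hi⟩).length ∧
      (fs'.drop i).flatten <+: fs.get ⟨i, hi⟩ := by
  have hd : (fs.drop i).flatten = fs.get ⟨i, hi⟩ ++ (fs.drop (i+1)).flatten := by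
    rw [List.drop_eq_getElem_cons hi, List.flatten_cons]; rfl
  have hd' : (fs'.drop i).flatten = fs'.get ⟨i, hi'⟩ ++ (fs'.drop (i+1)).flatten := by
    rw [List.drop_eq_getElem_cons hi', List.flatten_cons]; rfl
  have hs : s = (fs.take i).flatten ++ (fs.drop i).flatten := by
    rw [← List.flatten_append, List.take_append_drop]; exact hlz.1
  have hs' : s' = (fs'.take i).flatten ++ (fs'.drop i).flatten := by
    rw [← List.flatten_append, List.take_append_drop]; exact hlz'.1
  have hR : (fs'.drop i).flatten <+: (fs.drop i).flatten := by
    rw [hs, hs', heq] at hpre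
    exact (List.prefix_append_right_inj _).1 hpre
  have hg : fs.get ⟨i, hi⟩ <+: (fs.drop i).flatten := hd ▸ List.prefix_append _ _
  have hg' : fs'.get ⟨i, hi'⟩ <+: (fs'.drop i).flatten := hd' ▸ List.prefix_append _ _
  have h0 : fs.get ⟨i, hi⟩ ≠ [] := hlz.2.1 _ (List.get_mem _ _)
  have h0' : fs'.get ⟨i, hi'⟩ ≠ [] := hlz'.2.1 _ (List.get_mem _ _)
  have key : ((fs'.drop i).flatten).length ≤ (fs.get ⟨i, hi⟩).length := by
    by_contra hlt
    have hgR : fs.get ⟨i, hi⟩ <+: (fs'.drop i).flatten :=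
      List.prefix_of_prefix_length_le hg hR (by omega)
    have h1 := le_aux s' fs' fs hlz' i hi' heq.symm _ _ hs' hgR h0 (hlz.2.2 i hi).1
    have h2 := le_aux s fs fs' hlz i hi heq _ _ hs (hg'.trans hR) h0' (hlz'.2.2 i hi').1
    have l1 := List.length_pos_iff.2 h0
    have l2 := List.length_pos_iff.2 h0'
    rw [List.length_dropLast, List.length_dropLast] at h1 h2
    have hl : (fs.get ⟨i, hi⟩).length = (fs'.get ⟨i, hi'⟩).length := by omega
    exact hne ((List.prefix_of_prefix_length_le hgR hg' hl.le).eq_of_length hl)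
  exact ⟨key, List.prefix_of_prefix_length_le hR hg key⟩
end

section
/- Let s' be a prefix of a string s, let f_1 f_2 ⋯ f_z and f'_1 f'_2 ⋯ f'_{z'} be the LZ-End parsings of s and s' respectively with z' > z, and let i ≥ 0 be an index such that f_m = f'_m for all 1 ≤ m ≤ i and f_{i+1} ≠ f'_{i+1} (both defined). Set k = ⌊(z' − i)/2⌋. Then there exists a strictly decreasing sequence of indices i_1 > i_2 > ⋯ > i_k, all in [1..z], such that for every j with 1 ≤ j ≤ k, the string f'_{i+j} f'_{i+j+1} ⋯ f'_{z'−j+1} is a substring of the phrase f_{i_j}. -/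
theorem aux_prefix_dropLast {α : Type*} {t l : List α} (h : t <+: l) (hl : t.length < l.length) :
    t <+: l.dropLast := by
  refine List.prefix_of_prefix_length_le h (List.dropLast_prefix l) ?_
  rw [List.length_dropLast]; omega

/-- If no phrase boundary touches the occurrence of `w`, it lies inside one phrase minus its end. -/
theorem aux_inside {α : Type*} (fs : List (List α)) (w : List α) (A : List α) :
    ∀ (m : ℕ) (B : List α), m ≤ fs.length → A ++ w ++ B = (fs.take m).flatten →
      (∀ t ≤ m, ((fs.take t).flatten).length < A.length ∨
        A.length + w.length < ((fs.take t).flatten).length) →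
      ∃ q < m, w <:+: (fs.getD q []).dropLast := by
  intro m
  induction m with
  | zero =>
    intro B _ h hb
    have h1 := hb 0 le_rfl
    have h2 := congrArg List.length h
    simp only [List.take_zero, List.flatten_nil, List.length_nil, List.length_append] at h1 h2
    omega
  | succ m ih =>
    intro B hm h hb
    have hlt : m < fs.length := hm
    have hT : (fs.take (m+1)).flatten = (fs.take m).flatten ++ fs[m] := by
      rw [← List.take_append_getElem hlt, List.flatten_append]; simp only [List.flatten_singleton]
    have hgd : fs.getD m [] = fs[m] := by simp [List.getD, hlt]
    have hend := hb (m+1) le_rfl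
    rw [← h] at hend
    have hBpos : 0 < B.length := by
      simp at hend; omega
    rw [hT] at h
    rcases hb m (Nat.le_succ m) with h1 | h1
    · have hp : (fs.take m).flatten <+: A := by
        refine List.prefix_of_prefix_length_le (l₃ := A ++ w ++ B) ?_ ?_ h1.le
        · rw [h]; exact List.prefix_append _ _
        · rw [List.append_assoc]; exact List.prefix_append _ _
      obtain ⟨A2, hA2⟩ := hp
      rw [← hA2] at h
      simp only [List.append_assoc, List.append_cancel_left_eq] at h
      refine ⟨m, Nat.lt_succ_self m, ?_⟩
      rw [hgd, ← h]
      have : A2 ++ w <+: (A2 ++ (w ++ B)).dropLast := by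
        apply aux_prefix_dropLast
        · rw [← List.append_assoc]; exact List.prefix_append _ _
        · simp; omega
      exact (List.suffix_append A2 w).isInfix.trans this.isInfix
    · have hp : A ++ w <+: (fs.take m).flatten := by
        refine List.prefix_of_prefix_length_le (l₃ := A ++ w ++ B) ?_ ?_ ?_
        · exact List.prefix_append _ _
        · rw [h]; exact List.prefix_append _ _
        · simp only [List.length_append]; omega
      obtain ⟨B1, hB1⟩ := hp
      obtain ⟨q, hq, hw⟩ := ih B1 hlt.le hB1 (fun t ht => hb t (Nat.le_succ_of_le ht))
      exact ⟨q, Nat.lt_succ_of_lt hq, hw⟩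

theorem aux_take_drop {β : Type*} (l : List β) (n m : ℕ) (h : n + m + 2 ≤ l.length) :
    (l.drop n).take (m + 2) =
      l[n] :: ((l.drop (n+1)).take m ++ [l[n+m+1]]) := by
  rw [List.drop_eq_getElem_cons (by omega : n < l.length), List.take_succ_cons]
  congr 1
  have hm : m < (l.drop (n+1)).length := by simp; omega
  rw [← List.take_append_getElem hm]
  simp [List.getElem_drop, show n + 1 + m = n + m + 1 by omega]

theorem aux_flatten_split {α : Type*} (l : List (List α)) (n : ℕ) :
    l.flatten.drop ((l.take n).flatten).length = (l.drop n).flatten := by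
  conv_lhs => enter [2]; rw [← List.take_append_drop n l]
  rw [List.flatten_append, List.drop_left]

theorem aux_dropLast_drop {α : Type*} (l : List α) (n : ℕ) :
    l.dropLast.drop n = (l.drop n).dropLast := by
  simp only [List.dropLast_eq_take, List.drop_take, List.length_drop]
  congr 1; omega

theorem aux_step {α : Type*} (s' : List α) (fs fs' : List (List α))
    (hs : ∀ q (hq : q < fs.length), (fs[q]).dropLast ≠ [] →
      ∃ j ≤ q, (fs[q]).dropLast <:+ ((fs.take j).flatten))
    (hlz' : IsLZEnd s' fs')
    (i : ℕ) (hi : i < fs.length) (heq : fs.take i = fs'.take i)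
    (n m q : ℕ) (hn : i + n + m + 2 ≤ fs'.length) (hq : q ≤ i)
    (hW : ((fs'.drop (i+n)).take (m+2)).flatten <:+: (fs.getD q []).dropLast) :
    ∃ q' < q, ((fs'.drop (i+n+1)).take m).flatten <:+: (fs.getD q' []).dropLast := by
  obtain ⟨hflat, hnil, hgreedy⟩ := hlz'
  have hqlt : q < fs.length := by omega
  have hin : i + n < fs'.length := by omega
  have hgd : fs.getD q [] = fs[q] := by simp [List.getD, hqlt]
  have hane : fs'[i+n] ≠ [] := hnil _ (List.getElem_mem _)
  have hcne : fs'[i+n+m+1] ≠ [] := hnil _ (List.getElem_mem _)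
  have hsd : s'.drop ((fs'.take (i+n)).flatten).length =
      ((fs'.drop (i+n)).take (m+2)).flatten ++ ((fs'.drop (i+n)).drop (m+2)).flatten := by
    rw [hflat, aux_flatten_split, ← List.flatten_append, List.take_append_drop]
  rw [aux_take_drop _ _ _ hn] at hW hsd
  have hg := (hgreedy (i+n) hin).2
  simp only [List.get_eq_getElem] at hg
  have hflw : (fs'[i+n] :: ((fs'.drop (i+n+1)).take m ++ [fs'[i+n+m+1]])).flatten =
      fs'[i+n] ++ ((fs'.drop (i+n+1)).take m).flatten ++ fs'[i+n+m+1] := by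
    simp only [List.flatten_cons, List.flatten_append, List.flatten_nil, List.append_nil,
      List.append_assoc]
  rw [hflw] at hW hsd
  generalize ((fs'.drop (i+n+1)).take m).flatten = w at *
  generalize fs'[i+n+m+1] = c at *
  generalize fs'[i+n] = a at *
  have hapos : 0 < a.length := List.length_pos_iff.mpr hane
  have hcpos : 0 < c.length := List.length_pos_iff.mpr hcne
  rw [hgd] at hW
  have hdne : (fs[q]).dropLast ≠ [] := by
    intro h0
    rw [h0] at hW
    have := hW.length_le
    simp only [List.length_append, List.length_nil] at this
    omega
  obtain ⟨j, hj, hsuf⟩ := hs q hqlt hdne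
  obtain ⟨A, B, hAB⟩ := hW.trans hsuf.isInfix
  have hAB' : (A ++ a) ++ w ++ (c ++ B) = (fs.take j).flatten := by
    rw [← hAB]; simp only [List.append_assoc]
  obtain ⟨q', hq', hw⟩ := aux_inside fs w (A ++ a) j (c ++ B) (by omega) hAB' (by
    intro t ht
    by_contra hcon
    push Not at hcon
    obtain ⟨hc1, hc2⟩ := hcon
    have htake : fs.take t = fs'.take t := by
      have := congrArg (List.take t) heq
      rwa [List.take_take, List.take_take, min_eq_left (by omega)] at this
    have hTp : (fs.take t).flatten <+: (A ++ a) ++ w := by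
      refine List.prefix_of_prefix_length_le (l₃ := (fs.take j).flatten) ?_ ?_ ?_
      · exact (List.take_prefix_take_left ht).flatten
      · rw [← hAB']; exact List.prefix_append _ _
      · simp only [List.length_append] at hc2 ⊢; omega
    have hAa : A ++ a <+: (fs.take t).flatten :=
      List.prefix_of_prefix_length_le (List.prefix_append _ _) hTp hc1
    obtain ⟨u, hu⟩ := hAa
    rw [← hu, List.prefix_append_right_inj] at hTp
    have hul := hTp.length_le
    have key := hg (a ++ u) (by
      rw [aux_dropLast_drop, hsd]
      apply aux_prefix_dropLast
      · rw [List.append_assoc, List.append_assoc, List.prefix_append_right_inj]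
        exact hTp.trans (List.prefix_append _ _)
      · simp only [List.length_append]; omega)
      ⟨t, by omega, by
        rw [← htake, ← hu, List.append_assoc]; exact List.suffix_append _ _⟩
    simp only [List.length_append, List.length_dropLast] at key
    omega)
  exact ⟨q', by omega, hw⟩

theorem aux_base {α : Type*} (s s' : List α) (fs fs' : List (List α))
    (hlz : IsLZEnd s fs) (hlz' : IsLZEnd s' fs') (hpre : s' <+: s)
    (i : ℕ) (hi : i < fs.length) (hi' : i < fs'.length)
    (heq : fs.take i = fs'.take i)
    (hne : fs[i] ≠ fs'[i]) :
    (fs'.drop i).flatten <:+: (fs.getD i []).dropLast := by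
  obtain ⟨hflat, hnil, hgreedy⟩ := hlz
  obtain ⟨hflat', hnil', hgreedy'⟩ := hlz'
  have hgd : fs.getD i [] = fs[i] := by simp [List.getD, hi]
  have hfpos : 0 < (fs[i]).length := List.length_pos_iff.mpr (hnil _ (List.getElem_mem _))
  have hfpos' : 0 < (fs'[i]).length := List.length_pos_iff.mpr (hnil' _ (List.getElem_mem _))
  have hsuf : ∃ j ≤ i, (fs[i]).dropLast <:+ ((fs.take j).flatten) := by
    by_cases h0 : (fs[i]).dropLast = []
    · exact ⟨0, Nat.zero_le _, by rw [h0]; exact List.nil_suffix⟩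
    · exact (hgreedy i hi).1 h0
  have hsuf' : ∃ j ≤ i, (fs'[i]).dropLast <:+ ((fs'.take j).flatten) := by
    by_cases h0 : (fs'[i]).dropLast = []
    · exact ⟨0, Nat.zero_le _, by rw [h0]; exact List.nil_suffix⟩
    · exact (hgreedy' i hi').1 h0
  have htake : ∀ t ≤ i, fs.take t = fs'.take t := by
    intro t ht
    have := congrArg (List.take t) heq
    rwa [List.take_take, List.take_take, min_eq_left ht] at this
  have hR : s.drop ((fs.take i).flatten).length = (fs.drop i).flatten := by
    rw [hflat, aux_flatten_split]
  have hR' : s'.drop ((fs'.take i).flatten).length = (fs'.drop i).flatten := by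
    rw [hflat', aux_flatten_split]
  have hRR : (fs'.drop i).flatten <+: (fs.drop i).flatten := by
    rw [← hR, ← hR', heq]; exact hpre.drop _
  have hfR : fs[i] <+: (fs.drop i).flatten := by
    rw [List.drop_eq_getElem_cons hi]; exact List.prefix_append _ _
  have hfR' : fs'[i] <+: (fs'.drop i).flatten := by
    rw [List.drop_eq_getElem_cons hi']; exact List.prefix_append _ _
  have hlt : ((fs'.drop i).flatten).length < (fs[i]).length := by
    by_contra hcon
    push Not at hcon
    have hp : fs[i] <+: (fs'.drop i).flatten := List.prefix_of_prefix_length_le hfR hRR hcon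
    obtain ⟨j, hj, hjs⟩ := hsuf
    obtain ⟨j', hj', hjs'⟩ := hsuf'
    have h1 := (hgreedy' i hi').2 (fs[i]).dropLast (by
      rw [aux_dropLast_drop, hR']
      apply aux_prefix_dropLast ((List.dropLast_prefix _).trans hp)
      rw [List.length_dropLast]; omega) ⟨j, hj, by rw [← htake j hj]; exact hjs⟩
    have hl' := hfR'.length_le
    have hl := hRR.length_le
    have h2 := (hgreedy i hi).2 (fs'[i]).dropLast (by
      rw [aux_dropLast_drop, hR]
      apply aux_prefix_dropLast ((List.dropLast_prefix _).trans (hfR'.trans hRR))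
      rw [List.length_dropLast]; omega) ⟨j', hj', by rw [htake j' hj']; exact hjs'⟩
    simp only [List.length_dropLast, List.get_eq_getElem] at h1 h2
    exact hne ((List.prefix_of_prefix_length_le hp hfR' (by omega)).eq_of_length (by omega))
  rw [hgd]
  exact (aux_prefix_dropLast (List.prefix_of_prefix_length_le hRR hfR hlt.le) hlt).isInfix

/-- the descending-sequence claim in the proof of Lemma 4.
Let `s'` be a prefix of a string `s`, let `f₁ ⋯ f_z` and `f'₁ ⋯ f'_{z'}` be
the LZ-End parsings of `s` and `s'` with `z' > z`, and let `i ≥ 0` (0-based)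
be an index such that the first `i` phrases coincide while the `(i+1)`-st
phrases exist and differ. Set `k = ⌊(z' − i)/2⌋`. Then there exists a strictly
decreasing sequence of indices `i₁ > i₂ > ⋯ > i_k`, all in `[1..z]` (1-based),
such that for every `j ∈ [1..k]` the string `f'_{i+j} f'_{i+j+1} ⋯ f'_{z'−j+1}`
is a substring (infix) of the phrase `f_{i_j}`. -/
theorem lzEnd_descending_sequence
    {α : Type*} (s s' : List α) (fs fs' : List (List α))
    (hlz : IsLZEnd s fs) (hlz' : IsLZEnd s' fs') (hpre : s' <+: s)
    (hz : fs.length < fs'.length)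
    (i : ℕ) (hi : i < fs.length) (hi' : i < fs'.length)
    (heq : fs.take i = fs'.take i)
    (hne : fs.get ⟨i, hi⟩ ≠ fs'.get ⟨i, hi'⟩) :
    ∃ g : ℕ → ℕ,
      (∀ j, 1 ≤ j → j < (fs'.length - i) / 2 → g (j + 1) < g j) ∧
      (∀ j, 1 ≤ j → j ≤ (fs'.length - i) / 2 →
        1 ≤ g j ∧ g j ≤ fs.length ∧
        ((fs'.drop (i + j - 1)).take (fs'.length - i - 2 * j + 2)).flatten
          <:+: fs.getD (g j - 1) []) := by
  have hbase := aux_base s s' fs fs' hlz hlz' hpre i hi hi' heq hne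
  have hstep : ∀ n q : ℕ, ∃ q', (2 * n + 4 ≤ fs'.length - i → q ≤ i →
      ((fs'.drop (i+n)).take (fs'.length - i - 2 * n)).flatten <:+: (fs.getD q []).dropLast →
      q' < q ∧ ((fs'.drop (i+(n+1))).take (fs'.length - i - 2 * (n+1))).flatten <:+:
        (fs.getD q' []).dropLast) := by
    intro n q
    by_cases h : 2 * n + 4 ≤ fs'.length - i ∧ q ≤ i ∧
      ((fs'.drop (i+n)).take (fs'.length - i - 2 * n)).flatten <:+: (fs.getD q []).dropLast
    · obtain ⟨h1, h2, h3⟩ := h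
      rw [show fs'.length - i - 2 * n = (fs'.length - i - 2 * (n+1)) + 2 by omega] at h3
      obtain ⟨q', hq', hw⟩ := aux_step s' fs fs' (fun q hq => (hlz.2.2 q hq).1) hlz' i hi heq n
        (fs'.length - i - 2 * (n+1)) q (by omega) h2 h3
      exact ⟨q', fun _ _ _ => ⟨hq', hw⟩⟩
    · exact ⟨0, fun h1 h2 h3 => absurd ⟨h1, h2, h3⟩ h⟩
  choose h hh using hstep
  let G : ℕ → ℕ := fun n => Nat.rec i (fun n q => h n q) n
  have hG0 : G 0 = i := rfl
  have hGs : ∀ n, G (n+1) = h n (G n) := fun n => rfl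
  have hinv : ∀ n, 2 * n + 2 ≤ fs'.length - i → G n ≤ i ∧
      ((fs'.drop (i+n)).take (fs'.length - i - 2 * n)).flatten <:+:
        (fs.getD (G n) []).dropLast := by
    intro n
    induction n with
    | zero =>
      intro _
      refine ⟨le_rfl, ?_⟩
      rw [hG0, List.take_of_length_le (by simp)]
      exact hbase
    | succ n ih =>
      intro hn
      obtain ⟨h1, h2⟩ := ih (by omega)
      obtain ⟨h3, h4⟩ := hh n (G n) (by omega) h1 h2
      rw [hGs]
      exact ⟨by omega, h4⟩
  refine ⟨fun j => G (j - 1) + 1, ?_, ?_⟩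
  · intro j hj1 hj2
    obtain ⟨n, rfl⟩ : ∃ n, j = n + 1 := ⟨j - 1, by omega⟩
    obtain ⟨h1, h2⟩ := hinv n (by omega)
    have h3 := (hh n (G n) (by omega) h1 h2).1
    simp only [Nat.add_sub_cancel, hGs]
    omega
  · intro j hj1 hj2
    obtain ⟨n, rfl⟩ : ∃ n, j = n + 1 := ⟨j - 1, by omega⟩
    obtain ⟨h1, h2⟩ := hinv n (by omega)
    simp only [Nat.add_sub_cancel]
    refine ⟨by omega, by omega, ?_⟩
    rw [show i + (n + 1) - 1 = i + n by omega,
      show fs'.length - i - 2 * (n + 1) + 2 = fs'.length - i - 2 * n by omega]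
    exact h2.trans (List.dropLast_prefix _).isInfix
end

section
/- Let f_1 f_2 ⋯ f_z be the LZ-End parsing of a string. Then for any indices k < j < z, the length of the longest common suffix of the strings f_1 f_2 ⋯ f_j and f_1 f_2 ⋯ f_k is strictly less than |f_j|. (Equivalently: the longest prefix of the reversal of f_1 ⋯ f_j that is a prefix of the reversal of some f_1 ⋯ f_k with k < j has length less than |f_j|.) -/
/-- Lemma 9 of the paper, reformulated. Let `f₁ f₂ ⋯ f_z` be
the LZ-End parsing of a string. Then for any indices `1 ≤ k < j < z`
(1-based), the length of the longest common suffix of the strings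
`f₁ f₂ ⋯ f_j` and `f₁ f₂ ⋯ f_k` is strictly less than `|f_j|`; i.e., every
common suffix `t` of these two strings satisfies `|t| < |f_j|`. -/
theorem lzEnd_common_suffix_short
    {α : Type*} (s : List α) (fs : List (List α)) (hlz : IsLZEnd s fs)
    (k j : ℕ) (hk : 1 ≤ k) (hkj : k < j) (hj : j < fs.length)
    (t : List α)
    (ht1 : t <:+ (fs.take j).flatten)
    (ht2 : t <:+ (fs.take k).flatten) :
    t.length < (fs.getD (j - 1) []).length := by
  obtain ⟨hs, hne, hmax⟩ := hlz
  obtain ⟨i, rfl⟩ : ∃ i, j = i + 1 := ⟨j - 1, by omega⟩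
  have hi : i < fs.length := by omega
  have hget : fs.getD (i + 1 - 1) [] = fs[i] := by simp [hi]
  rw [hget]
  by_contra hlt
  push Not at hlt
  have htake : (fs.take (i + 1)).flatten = (fs.take i).flatten ++ fs[i] := by
    rw [List.take_succ_eq_append_getElem hi, List.flatten_append, List.flatten_singleton]
  have hsuf : fs[i] <:+ (fs.take k).flatten :=
    (List.suffix_of_suffix_length_le (htake ▸ List.suffix_append _ _) ht1 hlt).trans ht2
  have hnext : fs[i + 1] ≠ [] := hne _ (List.getElem_mem hj)
  have hdrop : (fs.drop (i + 1)).flatten ≠ [] := by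
    rw [List.drop_eq_getElem_cons hj, List.flatten_cons]
    exact List.append_ne_nil_of_left_ne_nil hnext _
  have hsplit : s = ((fs.take i).flatten ++ fs[i]) ++ (fs.drop (i + 1)).flatten := by
    rw [← htake, ← List.flatten_append, List.take_append_drop, hs]
  have hpre : fs[i] <+: s.dropLast.drop ((fs.take i).flatten).length := by
    rw [hsplit, List.dropLast_append_of_ne_nil hdrop, List.append_assoc, List.drop_left]
    exact List.prefix_append _ _
  have h := (hmax i hi).2 fs[i] hpre ⟨k, by omega, hsuf⟩
  have hpos : 0 < fs[i].length := List.length_pos_iff.mpr (hne _ (List.getElem_mem hi))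
  simp only [List.get_eq_getElem, List.length_dropLast] at h
  omega
end
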